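/- arXiv:2509.10817 — 4 statements merged into one kernel-verified Lean document; each statement's English description precedes it below -/
import Mathlib

section
/- Let (Ω, 𝓕, P) be a probability space and let X : Ω → E₁, Y : Ω → E₂, Z : Ω → E₃ be measurable maps into standard Borel spaces. Let κ = condDistrib X Z P be a regular conditional distribution of X given Z. Then X and Y are conditionally independent given Z (i.e., conditionally independent given the σ-algebra generated by Z) if and only if the law of ((Y,Z), X) under P equals the composition-product of the law of (Y,Z) under P with the kernel (y,z) ↦ κ(z); equivalently, the joint law of (X,Y,Z) coincides with the law of the conditionally independent variant (X′,Y,Z), where X′ given Z has the same conditional distribution as X given Z and X′ is conditionally independent of Y given Z. -/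
open MeasureTheory ProbabilityTheory
open scoped ENNReal ProbabilityTheory

noncomputable section

/-- Pushing the base space of a composition-product with a pulled-back kernel along a measurable map. -/
lemma map_prodMap_compProd_comap {α β γ : Type*} [MeasurableSpace α] [MeasurableSpace β]
    [MeasurableSpace γ] (μ : Measure α) [SFinite μ] (κ : Kernel β γ) [IsSFiniteKernel κ]
    {g : α → β} (hg : Measurable g) :
    (μ ⊗ₘ κ.comap g hg).map (Prod.map g id) = μ.map g ⊗ₘ κ := by
  ext s hs
  rw [Measure.map_apply (hg.prodMap measurable_id) hs,
    Measure.compProd_apply (hg.prodMap measurable_id hs), Measure.compProd_apply hs,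
    lintegral_map (Kernel.measurable_kernel_prodMk_left hs) hg]
  rfl

/-- Characterization of conditional independence via the conditionally
independent variant: `X ⫫ Y | Z` if and only if the law of `((Y,Z),X)` equals the
composition-product of the law of `(Y,Z)` with the kernel `(y,z) ↦ condDistrib X Z P (z)`,
i.e. the joint law of `(X,Y,Z)` coincides with that of the CI variant `(X′,Y,Z)`. -/
theorem condIndepFun_iff_law_eq_compProd
    {Ω : Type*} [MeasurableSpace Ω] [StandardBorelSpace Ω] [Nonempty Ω]
    (P : Measure Ω) [IsProbabilityMeasure P]
    {E₁ E₂ E₃ : Type*}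
    [MeasurableSpace E₁] [StandardBorelSpace E₁] [Nonempty E₁]
    [MeasurableSpace E₂] [StandardBorelSpace E₂] [Nonempty E₂]
    [MeasurableSpace E₃] [StandardBorelSpace E₃] [Nonempty E₃]
    (X : Ω → E₁) (Y : Ω → E₂) (Z : Ω → E₃)
    (hX : Measurable X) (hY : Measurable Y) (hZ : Measurable Z) :
    CondIndepFun (MeasurableSpace.comap Z inferInstance) (hZ.comap_le) X Y P
      ↔ P.map (fun ω => ((Y ω, Z ω), X ω))
          = (P.map (fun ω => (Y ω, Z ω)))
              ⊗ₘ ((condDistrib X Z P).comap Prod.snd measurable_snd) := by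
  have hswap : Function.Injective
      (Measure.map (Prod.map Prod.swap id) : Measure ((E₂ × E₃) × E₁) → _) :=
    (MeasurableEquiv.prodComm.prodCongr (.refl E₁)).map_measurableEquiv_injective
  rw [← hswap.eq_iff]
  have hκ : (condDistrib X Z P).comap Prod.snd measurable_snd
      = ((condDistrib X Z P).prodMkRight E₂).comap Prod.swap measurable_swap := rfl
  rw [hκ, map_prodMap_compProd_comap _ _ measurable_swap,
    Measure.map_map (by fun_prop) (by fun_prop), Measure.map_map (by fun_prop) (by fun_prop)]
  exact (Iff.intro CondIndepFun.symm CondIndepFun.symm).trans <|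
    (condIndepFun_iff_condDistrib_prod_ae_eq_prodMkRight hX hY hZ).trans
      (condDistrib_ae_eq_iff_measure_eq_compProd _ hX.aemeasurable _)
end
end

section
/- Let σ > 0 and let ρ be a Borel probability measure on ℝ^d × ℝ^d. Define the first Hoeffding projection g₁(v,v′) = ∫ g((v,v′),(w,w′)) dρ(w,w′). Then for every (v,v′) ∈ ℝ^d × ℝ^d, g₁(v,v′)² ≤ 2·ζ_σ(ρ). -/
open MeasureTheory ProbabilityTheory Filter Real
open scoped ENNReal

noncomputable section

/-- The Gaussian kernel `K_σ(x,y) = exp(−(σ²/2)‖x−y‖²)`. -/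
def gaussKer {d : ℕ} (σ : ℝ) (x y : EuclideanSpace ℝ (Fin d)) : ℝ :=
  Real.exp (-(σ ^ 2 / 2) * ‖x - y‖ ^ 2)

/-- The population quantity `ζ_σ(ρ) = ∬K_σ dμ⊗μ + ∬K_σ dν⊗ν − 2∬K_σ dμ⊗ν`,
where `μ` and `ν` are the two marginals of `ρ`. -/
def zetaSigma {d : ℕ} (σ : ℝ) (ρ : Measure (EuclideanSpace ℝ (Fin d) × EuclideanSpace ℝ (Fin d))) :
    ℝ :=
  (∫ x, ∫ y, gaussKer σ x y ∂(ρ.map Prod.fst) ∂(ρ.map Prod.fst))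
    + (∫ x, ∫ y, gaussKer σ x y ∂(ρ.map Prod.snd) ∂(ρ.map Prod.snd))
    - 2 * ∫ x, ∫ y, gaussKer σ x y ∂(ρ.map Prod.snd) ∂(ρ.map Prod.fst)

/-- The core function
`g((v₁,v₁′),(v₂,v₂′)) = K_σ(v₁,v₂) + K_σ(v₁′,v₂′) − K_σ(v₁,v₂′) − K_σ(v₁′,v₂)`. -/
def coreFn {d : ℕ} (σ : ℝ)
    (w₁ w₂ : EuclideanSpace ℝ (Fin d) × EuclideanSpace ℝ (Fin d)) : ℝ :=
  gaussKer σ w₁.1 w₂.1 + gaussKer σ w₁.2 w₂.2 - gaussKer σ w₁.1 w₂.2 - gaussKer σ w₁.2 w₂.1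

/-- The first Hoeffding projection `g₁(v,v′) = ∫ g((v,v′),(w,w′)) dρ(w,w′)`. -/
def hoeffdingProj {d : ℕ} (σ : ℝ)
    (ρ : Measure (EuclideanSpace ℝ (Fin d) × EuclideanSpace ℝ (Fin d)))
    (w : EuclideanSpace ℝ (Fin d) × EuclideanSpace ℝ (Fin d)) : ℝ :=
  ∫ w', coreFn σ w w' ∂ρ

lemma integrable_cexp_inner_mul_I {E : Type*} [NormedAddCommGroup E] [InnerProductSpace ℝ E]
    [SecondCountableTopology E] [MeasurableSpace E] [BorelSpace E]
    (μ : Measure E) [IsFiniteMeasure μ] (x : E) :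
    Integrable (fun t ↦ Complex.exp ((inner ℝ t x : ℝ) * Complex.I)) μ :=
  .of_bound (Continuous.aestronglyMeasurable (by fun_prop)) 1
    (ae_of_all _ fun t ↦ (Complex.norm_exp_ofReal_mul_I _).le)

section StdGaussian

variable {E : Type*} [NormedAddCommGroup E] [InnerProductSpace ℝ E] [FiniteDimensional ℝ E]
  [MeasurableSpace E] [BorelSpace E]

lemma integral_cos_inner_stdGaussian (x : E) :
    ∫ t, cos (inner ℝ t x) ∂(stdGaussian E) = exp (-‖x‖ ^ 2 / 2) := by
  have h := congrArg Complex.re (charFun_stdGaussian x)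
  rw [charFun_apply, ← RCLike.re_eq_complex_re,
    ← integral_re (integrable_cexp_inner_mul_I _ x)] at h
  simp only [RCLike.re_eq_complex_re, Complex.exp_ofReal_mul_I_re] at h
  rw [h]
  exact_mod_cast Complex.exp_ofReal_re (-‖x‖ ^ (2 : ℕ) / 2)

lemma integral_sin_inner_stdGaussian (x : E) :
    ∫ t, sin (inner ℝ t x) ∂(stdGaussian E) = 0 := by
  have h := congrArg Complex.im (charFun_stdGaussian x)
  rw [charFun_apply, ← RCLike.im_eq_complex_im,
    ← integral_im (integrable_cexp_inner_mul_I _ x)] at h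
  simp only [RCLike.im_eq_complex_im, Complex.exp_ofReal_mul_I_im] at h
  rw [h]
  exact_mod_cast Complex.exp_ofReal_im (-‖x‖ ^ (2 : ℕ) / 2)

end StdGaussian

lemma integral_add_sub_sub {Ω : Type*} [MeasurableSpace Ω] {P : Measure Ω} {f g h k : Ω → ℝ}
    (hf : Integrable f P) (hg : Integrable g P) (hh : Integrable h P) (hk : Integrable k P) :
    ∫ ω, f ω + g ω - h ω - k ω ∂P
      = (∫ ω, f ω ∂P) + (∫ ω, g ω ∂P) - (∫ ω, h ω ∂P) - ∫ ω, k ω ∂P := by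
  have hfg : Integrable (fun ω ↦ f ω + g ω) P := hf.add hg
  have hfgh : Integrable (fun ω ↦ f ω + g ω - h ω) P := hfg.sub hh
  rw [integral_sub hfgh hk, integral_sub hfg hh, integral_add hf hg]

/-- The integral of `(s • f + g) ^ 2` is nonnegative. -/
lemma quadratic_integral_nonneg {Ω : Type*} [MeasurableSpace Ω] {P : Measure Ω} {f g : Ω → ℝ}
    (hff : Integrable (fun ω ↦ f ω * f ω) P) (hfg : Integrable (fun ω ↦ f ω * g ω) P)
    (hgg : Integrable (fun ω ↦ g ω * g ω) P) (s : ℝ) :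
    0 ≤ s ^ 2 * (∫ ω, f ω * f ω ∂P) + 2 * s * (∫ ω, f ω * g ω ∂P) + ∫ ω, g ω * g ω ∂P := by
  have hsum : Integrable (fun ω ↦ s ^ 2 * (f ω * f ω) + 2 * s * (f ω * g ω)) P :=
    (hff.const_mul _).add (hfg.const_mul _)
  rw [← integral_const_mul, ← integral_const_mul,
    ← integral_add (hff.const_mul _) (hfg.const_mul _), ← integral_add hsum hgg]
  refine integral_nonneg fun ω ↦ ?_
  have : 0 ≤ (s * f ω + g ω) ^ 2 := sq_nonneg _
  simp only [Pi.zero_apply]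
  linarith

section GaussKer

variable {d : ℕ} {σ : ℝ}

/-- A real random feature of the Gaussian kernel: the product of the features of `x` and `y` is
`cos (σ⟪t, x - y⟫) + sin (σ⟪t, x + y⟫)`, whose mean under a standard Gaussian `t` is `K_σ(x,y)`. -/
def gaussFeature (σ : ℝ) (x t : EuclideanSpace ℝ (Fin d)) : ℝ :=
  cos (inner ℝ t (σ • x)) + sin (inner ℝ t (σ • x))

/-- The kernel mean embedding of `μ` with respect to `gaussFeature`. -/
def meanFeature (σ : ℝ) (μ : Measure (EuclideanSpace ℝ (Fin d)))
    (t : EuclideanSpace ℝ (Fin d)) : ℝ :=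
  ∫ x, gaussFeature σ x t ∂μ

lemma continuous_uncurry_gaussFeature :
    Continuous (Function.uncurry (gaussFeature (d := d) σ)) := by
  unfold gaussFeature Function.uncurry
  fun_prop

lemma abs_gaussFeature_le (x t : EuclideanSpace ℝ (Fin d)) : |gaussFeature σ x t| ≤ 2 :=
  (abs_add_le _ _).trans <| by
    linarith [abs_cos_le_one (inner ℝ t (σ • x)), abs_sin_le_one (inner ℝ t (σ • x))]

lemma integral_gaussFeature_mul (x y : EuclideanSpace ℝ (Fin d)) :
    ∫ t, gaussFeature σ x t * gaussFeature σ y t ∂(stdGaussian _) = gaussKer σ x y := by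
  have h (t : EuclideanSpace ℝ (Fin d)) : gaussFeature σ x t * gaussFeature σ y t
      = cos (inner ℝ t (σ • x - σ • y)) + sin (inner ℝ t (σ • x + σ • y)) := by
    rw [inner_sub_right, inner_add_right, cos_sub, sin_add, gaussFeature, gaussFeature]
    ring
  simp_rw [h]
  rw [integral_add, integral_cos_inner_stdGaussian, integral_sin_inner_stdGaussian, add_zero,
    gaussKer, ← smul_sub, norm_smul, mul_pow, norm_eq_abs, sq_abs]
  · ring_nf
  · exact .of_bound (Continuous.aestronglyMeasurable (by fun_prop)) 1
      (ae_of_all _ fun t ↦ abs_cos_le_one _)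
  · exact .of_bound (Continuous.aestronglyMeasurable (by fun_prop)) 1
      (ae_of_all _ fun t ↦ abs_sin_le_one _)

lemma stronglyMeasurable_meanFeature (μ : Measure (EuclideanSpace ℝ (Fin d))) [SFinite μ] :
    StronglyMeasurable (meanFeature σ μ) :=
  continuous_uncurry_gaussFeature.stronglyMeasurable.integral_prod_left

lemma abs_meanFeature_le (μ : Measure (EuclideanSpace ℝ (Fin d))) [IsProbabilityMeasure μ]
    (t : EuclideanSpace ℝ (Fin d)) : |meanFeature σ μ t| ≤ 2 := by
  simpa [meanFeature] using norm_integral_le_of_norm_le_const (μ := μ)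
    (f := fun x ↦ gaussFeature σ x t) (ae_of_all _ fun x ↦ abs_gaussFeature_le x t)

lemma integrable_meanFeature_mul (μ ν : Measure (EuclideanSpace ℝ (Fin d)))
    [IsProbabilityMeasure μ] [IsProbabilityMeasure ν] :
    Integrable (fun t ↦ meanFeature σ μ t * meanFeature σ ν t) (stdGaussian _) :=
  .of_bound ((stronglyMeasurable_meanFeature μ).mul
    (stronglyMeasurable_meanFeature ν)).aestronglyMeasurable (2 * 2)
    (ae_of_all _ fun t ↦ by
      rw [norm_mul]
      exact mul_le_mul (abs_meanFeature_le μ t) (abs_meanFeature_le ν t) (abs_nonneg _) zero_le_two)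

lemma integral_integral_gaussKer (μ ν : Measure (EuclideanSpace ℝ (Fin d)))
    [IsProbabilityMeasure μ] [IsProbabilityMeasure ν] :
    ∫ x, ∫ y, gaussKer σ x y ∂ν ∂μ
      = ∫ t, meanFeature σ μ t * meanFeature σ ν t ∂(stdGaussian _) := by
  have inner_eq (x : EuclideanSpace ℝ (Fin d)) : ∫ y, gaussKer σ x y ∂ν
      = ∫ t, gaussFeature σ x t * meanFeature σ ν t ∂(stdGaussian _) := by
    simp_rw [← integral_gaussFeature_mul]
    rw [integral_integral_swap]
    · simp_rw [integral_const_mul, meanFeature]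
    · refine .of_bound (Continuous.aestronglyMeasurable ?_) (2 * 2) (ae_of_all _ fun p ↦ ?_)
      · unfold gaussFeature Function.uncurry
        fun_prop
      · rw [Function.uncurry, norm_mul]
        exact mul_le_mul (abs_gaussFeature_le _ _) (abs_gaussFeature_le _ _) (abs_nonneg _)
          zero_le_two
  simp_rw [inner_eq]
  rw [integral_integral_swap]
  · simp_rw [integral_mul_const, meanFeature]
  · refine .of_bound (StronglyMeasurable.aestronglyMeasurable
      (continuous_uncurry_gaussFeature.stronglyMeasurable.mul
        ((stronglyMeasurable_meanFeature ν).comp_measurable measurable_snd)))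
      (2 * 2) (ae_of_all _ fun p ↦ ?_)
    rw [Function.uncurry, norm_mul]
    exact mul_le_mul (abs_gaussFeature_le _ _) (abs_meanFeature_le _ _) (abs_nonneg _) zero_le_two

lemma integral_meanFeature_sub_mul_sub (μ₁ ν₁ μ₂ ν₂ : Measure (EuclideanSpace ℝ (Fin d)))
    [IsProbabilityMeasure μ₁] [IsProbabilityMeasure ν₁]
    [IsProbabilityMeasure μ₂] [IsProbabilityMeasure ν₂] :
    ∫ t, (meanFeature σ μ₁ t - meanFeature σ ν₁ t) * (meanFeature σ μ₂ t - meanFeature σ ν₂ t)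
        ∂(stdGaussian _)
      = (∫ x, ∫ y, gaussKer σ x y ∂μ₂ ∂μ₁) + (∫ x, ∫ y, gaussKer σ x y ∂ν₂ ∂ν₁)
        - (∫ x, ∫ y, gaussKer σ x y ∂ν₂ ∂μ₁) - ∫ x, ∫ y, gaussKer σ x y ∂μ₂ ∂ν₁ := by
  simp_rw [integral_integral_gaussKer]
  rw [← integral_add_sub_sub (integrable_meanFeature_mul μ₁ μ₂) (integrable_meanFeature_mul ν₁ ν₂)
    (integrable_meanFeature_mul μ₁ ν₂) (integrable_meanFeature_mul ν₁ μ₂)]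
  congr with t
  ring

lemma integrable_meanFeature_sub_mul_sub (μ₁ ν₁ μ₂ ν₂ : Measure (EuclideanSpace ℝ (Fin d)))
    [IsProbabilityMeasure μ₁] [IsProbabilityMeasure ν₁]
    [IsProbabilityMeasure μ₂] [IsProbabilityMeasure ν₂] :
    Integrable (fun t ↦ (meanFeature σ μ₁ t - meanFeature σ ν₁ t)
      * (meanFeature σ μ₂ t - meanFeature σ ν₂ t)) (stdGaussian _) := by
  convert (((integrable_meanFeature_mul (σ := σ) μ₁ μ₂).add
    (integrable_meanFeature_mul ν₁ ν₂)).sub (integrable_meanFeature_mul μ₁ ν₂)).sub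
      (integrable_meanFeature_mul ν₁ μ₂) using 2 with t
  simp only [Pi.add_apply, Pi.sub_apply]
  ring

lemma integrable_gaussKer (x : EuclideanSpace ℝ (Fin d))
    {Ω : Type*} [MeasurableSpace Ω] (P : Measure Ω) [IsFiniteMeasure P]
    {X : Ω → EuclideanSpace ℝ (Fin d)} (hX : Measurable X) :
    Integrable (fun ω ↦ gaussKer σ x (X ω)) P := by
  refine .of_bound (Measurable.aestronglyMeasurable ?_) 1 (ae_of_all _ fun ω ↦ ?_)
  · unfold gaussKer
    fun_prop
  · rw [gaussKer, norm_eq_abs, abs_exp, exp_le_one_iff, neg_mul]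
    exact neg_nonpos.2 (by positivity)

lemma hoeffdingProj_eq (ρ : Measure (EuclideanSpace ℝ (Fin d) × EuclideanSpace ℝ (Fin d)))
    [IsFiniteMeasure ρ] (w : EuclideanSpace ℝ (Fin d) × EuclideanSpace ℝ (Fin d)) :
    hoeffdingProj σ ρ w
      = (∫ y, gaussKer σ w.1 y ∂(ρ.map Prod.fst)) + (∫ y, gaussKer σ w.2 y ∂(ρ.map Prod.snd))
        - (∫ y, gaussKer σ w.1 y ∂(ρ.map Prod.snd)) - ∫ y, gaussKer σ w.2 y ∂(ρ.map Prod.fst) := by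
  have hi₁ (x : EuclideanSpace ℝ (Fin d)) := integrable_gaussKer (σ := σ) x ρ measurable_fst
  have hi₂ (x : EuclideanSpace ℝ (Fin d)) := integrable_gaussKer (σ := σ) x ρ measurable_snd
  have hm (x : EuclideanSpace ℝ (Fin d)) (ν : Measure (EuclideanSpace ℝ (Fin d)))
      [IsFiniteMeasure ν] :
      AEStronglyMeasurable (gaussKer σ x) ν :=
    (integrable_gaussKer x ν measurable_id).aestronglyMeasurable
  rw [integral_map measurable_fst.aemeasurable (hm _ _),
    integral_map measurable_fst.aemeasurable (hm _ _),
    integral_map measurable_snd.aemeasurable (hm _ _),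
    integral_map measurable_snd.aemeasurable (hm _ _),
    ← integral_add_sub_sub (hi₁ _) (hi₂ _) (hi₂ _) (hi₁ _)]
  rfl

end GaussKer

/-- For `σ > 0` and a Borel probability measure `ρ` on `ℝ^d × ℝ^d`, the first
Hoeffding projection satisfies `g₁(v,v′)² ≤ 2 ζ_σ(ρ)` for every `(v,v′)`. -/
theorem hoeffdingProj_sq_le
    {d : ℕ} {σ : ℝ} (hσ : 0 < σ)
    (ρ : Measure (EuclideanSpace ℝ (Fin d) × EuclideanSpace ℝ (Fin d)))
    [IsProbabilityMeasure ρ]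
    (w : EuclideanSpace ℝ (Fin d) × EuclideanSpace ℝ (Fin d)) :
    (hoeffdingProj σ ρ w) ^ 2 ≤ 2 * zetaSigma σ ρ := by
  have : IsProbabilityMeasure (ρ.map Prod.fst) :=
    Measure.isProbabilityMeasure_map measurable_fst.aemeasurable
  have : IsProbabilityMeasure (ρ.map Prod.snd) :=
    Measure.isProbabilityMeasure_map measurable_snd.aemeasurable
  have hA := integral_meanFeature_sub_mul_sub (σ := σ) (.dirac w.1) (.dirac w.2)
    (.dirac w.1) (.dirac w.2)
  have hB := integral_meanFeature_sub_mul_sub (σ := σ) (.dirac w.1) (.dirac w.2)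
    (ρ.map Prod.fst) (ρ.map Prod.snd)
  have hZ := integral_meanFeature_sub_mul_sub (σ := σ) (ρ.map Prod.fst) (ρ.map Prod.snd)
    (ρ.map Prod.fst) (ρ.map Prod.snd)
  have hiA := integrable_meanFeature_sub_mul_sub (σ := σ) (.dirac w.1) (.dirac w.2)
    (.dirac w.1) (.dirac w.2)
  have hiB := integrable_meanFeature_sub_mul_sub (σ := σ) (.dirac w.1) (.dirac w.2)
    (ρ.map Prod.fst) (ρ.map Prod.snd)
  have hiZ := integrable_meanFeature_sub_mul_sub (σ := σ) (ρ.map Prod.fst) (ρ.map Prod.snd)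
    (ρ.map Prod.fst) (ρ.map Prod.snd)
  have hsymm : ∫ x, ∫ y, gaussKer σ x y ∂(ρ.map Prod.fst) ∂(ρ.map Prod.snd)
      = ∫ x, ∫ y, gaussKer σ x y ∂(ρ.map Prod.snd) ∂(ρ.map Prod.fst) := by
    simp_rw [integral_integral_gaussKer, mul_comm]
  simp only [integral_dirac] at hA hB
  rw [← hoeffdingProj_eq] at hB
  replace hZ := hZ.trans (show _ = zetaSigma σ ρ by rw [hsymm, zetaSigma]; ring)
  set a := fun t ↦ meanFeature σ (.dirac w.1) t - meanFeature σ (.dirac w.2) t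
  set m := fun t ↦ meanFeature σ (ρ.map Prod.fst) t - meanFeature σ (ρ.map Prod.snd) t
  have hA_le : ∫ t, a t * a t ∂(stdGaussian _) ≤ 2 := by
    refine hA.trans_le ?_
    simp only [gaussKer, sub_self, norm_zero]
    norm_num
    linarith [exp_pos (-(σ ^ 2 / 2 * ‖w.1 - w.2‖ ^ 2)), exp_pos (-(σ ^ 2 / 2 * ‖w.2 - w.1‖ ^ 2))]
  rw [← hB, ← hZ]
  set B := ∫ t, a t * m t ∂(stdGaussian _)
  nlinarith [quadratic_integral_nonneg hiA hiB hiZ (-B / 2), mul_le_mul_of_nonneg_left hA_le (sq_nonneg (-B / 2))]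
end
end

section
/- Let n ≥ 2, α ∈ (0,1), σ > 0, and let v₁,…,v_n, v₁′,…,v_n′ ∈ ℝ^d be arbitrary points. For π ∈ {0,1}^n set u_i(π) = π(i)·v_i + (1−π(i))·v_i′ and u_i′(π) = (1−π(i))·v_i + π(i)·v_i′, and define s(π) = (n choose 2)^{−1} Σ_{1≤i<j≤n} g((u_i(π),u_i′(π)),(u_j(π),u_j′(π))). Define the resampling critical value ĉ_{1−α} = inf{ t ∈ ℝ : 2^{−n}·#{π ∈ {0,1}^n : s(π) ≤ t} ≥ 1−α }. Then ĉ_{1−α} ≤ 2/(α·(n−1)). -/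
open MeasureTheory ProbabilityTheory Filter Real
open scoped ENNReal

noncomputable section

/-- The swapped configuration: `u_i(τ) = τ(i)v_i + (1−τ(i))v_i′` and
`u_i′(τ) = (1−τ(i))v_i + τ(i)v_i′`, encoding `τ(i) = 1` as `true`. -/
def swapPair {d : ℕ} {n : ℕ} (v v' : Fin n → EuclideanSpace ℝ (Fin d)) (τ : Fin n → Bool)
    (i : Fin n) : EuclideanSpace ℝ (Fin d) × EuclideanSpace ℝ (Fin d) :=
  if τ i then (v i, v' i) else (v' i, v i)

/-- The resampled statistic `s(τ) = (n choose 2)⁻¹ Σ_{i<j} g(u_i(τ),u_i′(τ)),(u_j(τ),u_j′(τ))`. -/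
def swapStat {d : ℕ} (σ : ℝ) {n : ℕ} (v v' : Fin n → EuclideanSpace ℝ (Fin d))
    (τ : Fin n → Bool) : ℝ :=
  ((n.choose 2 : ℝ))⁻¹ *
    ∑ i : Fin n, ∑ j : Fin n,
      if i < j then coreFn σ (swapPair v v' τ i) (swapPair v v' τ j) else 0

/-- The resampling critical value
`ĉ_{1−α} = inf{t : 2^{−n} #{τ : s(τ) ≤ t} ≥ 1 − α}`. -/
def critVal {d : ℕ} (σ : ℝ) {n : ℕ} (α : ℝ)
    (v v' : Fin n → EuclideanSpace ℝ (Fin d)) : ℝ :=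
  sInf {t : ℝ |
    1 - α ≤ ((2 : ℝ) ^ n)⁻¹ *
      ((Finset.univ.filter fun τ : Fin n → Bool => swapStat σ v v' τ ≤ t).card : ℝ)}

/-- The sign `±1` attached to a Boolean. -/
def boolSign (b : Bool) : ℝ := if b then 1 else -1

lemma boolSign_mul_self (b : Bool) : boolSign b * boolSign b = 1 := by
  cases b <;> simp [boolSign]

lemma boolSign_not (b : Bool) : boolSign (!b) = -boolSign b := by
  cases b <;> simp [boolSign]

/-- Negating the `m`-th coordinate of a Boolean vector. -/
def flipAt {ι : Type*} [DecidableEq ι] (m : ι) (τ : ι → Bool) : ι → Bool :=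
  Function.update τ m (!τ m)

lemma flipAt_involutive {ι : Type*} [DecidableEq ι] (m : ι) :
    Function.Involutive (flipAt m : (ι → Bool) → ι → Bool) := by
  intro τ
  simp [flipAt]

lemma boolSign_flipAt_self {ι : Type*} [DecidableEq ι] (m : ι) (τ : ι → Bool) :
    boolSign (flipAt m τ m) = -boolSign (τ m) := by
  simp [flipAt, boolSign_not]

lemma flipAt_of_ne {ι : Type*} [DecidableEq ι] {m i : ι} (h : i ≠ m) (τ : ι → Bool) :
    flipAt m τ i = τ i := by
  simp [flipAt, h]

lemma sum_eq_zero_of_flipAt {ι : Type*} [Fintype ι] [DecidableEq ι] (m : ι)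
    (F : (ι → Bool) → ℝ) (h : ∀ τ, F (flipAt m τ) = -F τ) : ∑ τ, F τ = 0 := by
  have h1 : ∑ τ, F (flipAt m τ) = ∑ τ, F τ :=
    Equiv.sum_comp ((flipAt_involutive m).toPerm) F
  simp only [h, Finset.sum_neg_distrib] at h1
  linarith

lemma sum_boolSign_pair {ι : Type*} [Fintype ι] [DecidableEq ι] {i j : ι} (h : i ≠ j) :
    ∑ τ : ι → Bool, boolSign (τ i) * boolSign (τ j) = 0 := by
  refine sum_eq_zero_of_flipAt i _ fun τ => ?_
  rw [boolSign_flipAt_self, flipAt_of_ne h.symm]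
  ring

lemma sum_boolSign_pair_mul_pair {ι : Type*} [Fintype ι] [LinearOrder ι] {p q : ι × ι}
    (hp : p.1 < p.2) (hq : q.1 < q.2) :
    ∑ τ : ι → Bool, (boolSign (τ p.1) * boolSign (τ p.2)) *
      (boolSign (τ q.1) * boolSign (τ q.2)) =
      if p = q then (2 : ℝ) ^ Fintype.card ι else 0 := by
  obtain ⟨i, j⟩ := p
  obtain ⟨k, l⟩ := q
  dsimp only at hp hq ⊢
  split_ifs with h
  · obtain ⟨rfl, rfl⟩ := Prod.mk.inj h
    have h1 (τ : ι → Bool) : (boolSign (τ i) * boolSign (τ j)) *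
        (boolSign (τ i) * boolSign (τ j)) = 1 := by
      rw [mul_mul_mul_comm, boolSign_mul_self, boolSign_mul_self, one_mul]
    simp [h1]
  · by_cases hi : k ≠ i ∧ l ≠ i
    · refine sum_eq_zero_of_flipAt i _ fun τ => ?_
      rw [boolSign_flipAt_self, flipAt_of_ne hp.ne', flipAt_of_ne hi.1, flipAt_of_ne hi.2]
      ring
    · have hj : k ≠ j ∧ l ≠ j := by
        constructor
        · rintro rfl
          exact hi ⟨hp.ne', (hp.trans hq).ne'⟩
        · rintro rfl
          refine hi ⟨?_, hp.ne'⟩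
          rintro rfl
          exact h rfl
      refine sum_eq_zero_of_flipAt j _ fun τ => ?_
      rw [boolSign_flipAt_self, flipAt_of_ne hp.ne, flipAt_of_ne hj.1, flipAt_of_ne hj.2]
      ring

/-- The second moment of a quadratic Rademacher chaos. -/
lemma sum_sq_sum_mul_boolSign {ι : Type*} [Fintype ι] [LinearOrder ι] (P : Finset (ι × ι))
    (hP : ∀ p ∈ P, p.1 < p.2) (a : ι × ι → ℝ) :
    ∑ τ : ι → Bool, (∑ p ∈ P, boolSign (τ p.1) * boolSign (τ p.2) * a p) ^ 2 =
      2 ^ Fintype.card ι * ∑ p ∈ P, a p ^ 2 := by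
  simp only [sq (Finset.sum _ _), Finset.sum_mul_sum]
  rw [Finset.sum_comm, Finset.mul_sum]
  refine Finset.sum_congr rfl fun p hp => ?_
  rw [Finset.sum_comm]
  have h (q : ι × ι) (hq : q ∈ P) : ∑ τ : ι → Bool,
      boolSign (τ p.1) * boolSign (τ p.2) * a p * (boolSign (τ q.1) * boolSign (τ q.2) * a q) =
      if p = q then 2 ^ Fintype.card ι * a p ^ 2 else 0 := by
    have h1 (τ : ι → Bool) : boolSign (τ p.1) * boolSign (τ p.2) * a p *
        (boolSign (τ q.1) * boolSign (τ q.2) * a q) =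
        (boolSign (τ p.1) * boolSign (τ p.2)) * (boolSign (τ q.1) * boolSign (τ q.2)) *
          (a p * a q) := by ring
    simp only [h1]
    rw [← Finset.sum_mul, sum_boolSign_pair_mul_pair (hP p hp) (hP q hq)]
    split_ifs with hpq
    · rw [hpq, sq]
    · rw [zero_mul]
  rw [Finset.sum_congr rfl h, Finset.sum_ite_eq, if_pos hp]

lemma card_filter_fst_lt_snd (n : ℕ) :
    (Finset.univ.filter fun p : Fin n × Fin n => p.1 < p.2).card = n.choose 2 := by
  have h (j : Fin n) : ∑ i : Fin n, (if i < j then 1 else 0) = (j : ℕ) := by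
    rw [← Finset.card_filter, Finset.filter_gt_eq_Iio, Fin.card_Iio]
  rw [Finset.card_filter, Fintype.sum_prod_type_right]
  simp only [h]
  rw [Fin.sum_univ_eq_sum_range (fun i => i), Finset.sum_range_id, Nat.choose_two_right]

lemma gaussKer_pos {d : ℕ} (σ : ℝ) (x y : EuclideanSpace ℝ (Fin d)) : 0 < gaussKer σ x y :=
  Real.exp_pos _

lemma gaussKer_le_one {d : ℕ} (σ : ℝ) (x y : EuclideanSpace ℝ (Fin d)) : gaussKer σ x y ≤ 1 := by
  refine Real.exp_le_one_iff.2 ?_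
  have : 0 ≤ σ ^ 2 / 2 * ‖x - y‖ ^ 2 := by positivity
  linarith

lemma coreFn_sq_le {d : ℕ} (σ : ℝ) (w₁ w₂ : EuclideanSpace ℝ (Fin d) × EuclideanSpace ℝ (Fin d)) :
    coreFn σ w₁ w₂ ^ 2 ≤ 4 := by
  have h (x y : EuclideanSpace ℝ (Fin d)) := And.intro (gaussKer_pos σ x y) (gaussKer_le_one σ x y)
  have h1 := h w₁.1 w₂.1
  have h2 := h w₁.2 w₂.2
  have h3 := h w₁.1 w₂.2
  have h4 := h w₁.2 w₂.1
  have : |coreFn σ w₁ w₂| ≤ 2 := by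
    rw [coreFn, abs_le]
    constructor <;> linarith
  calc coreFn σ w₁ w₂ ^ 2 ≤ 2 ^ 2 := sq_le_sq' (abs_le.1 this).1 (abs_le.1 this).2
    _ = 4 := by norm_num

lemma coreFn_swapPair {d n : ℕ} (σ : ℝ) (v v' : Fin n → EuclideanSpace ℝ (Fin d))
    (τ : Fin n → Bool) (i j : Fin n) :
    coreFn σ (swapPair v v' τ i) (swapPair v v' τ j) =
      boolSign (τ i) * boolSign (τ j) * coreFn σ (v i, v' i) (v j, v' j) := by
  cases hi : τ i <;> cases hj : τ j <;> simp [swapPair, coreFn, boolSign, hi, hj] <;> ring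

lemma swapStat_eq {d n : ℕ} (σ : ℝ) (v v' : Fin n → EuclideanSpace ℝ (Fin d))
    (τ : Fin n → Bool) :
    swapStat σ v v' τ = (n.choose 2 : ℝ)⁻¹ *
      ∑ p ∈ Finset.univ.filter (fun p : Fin n × Fin n => p.1 < p.2),
        boolSign (τ p.1) * boolSign (τ p.2) * coreFn σ (v p.1, v' p.1) (v p.2, v' p.2) := by
  simp only [swapStat, coreFn_swapPair, Finset.sum_filter, Fintype.sum_prod_type]

lemma sum_swapStat {d n : ℕ} (σ : ℝ) (v v' : Fin n → EuclideanSpace ℝ (Fin d)) :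
    ∑ τ, swapStat σ v v' τ = 0 := by
  simp only [swapStat_eq]
  rw [← Finset.mul_sum, Finset.sum_comm, Finset.sum_eq_zero, mul_zero]
  intro p hp
  rw [← Finset.sum_mul, sum_boolSign_pair (Finset.mem_filter.1 hp).2.ne, zero_mul]

lemma sum_swapStat_sq_le {d n : ℕ} (hn : 2 ≤ n) (σ : ℝ)
    (v v' : Fin n → EuclideanSpace ℝ (Fin d)) :
    ∑ τ, swapStat σ v v' τ ^ 2 ≤ 2 ^ n * (4 / (n.choose 2 : ℝ)) := by
  have hC : 0 < (n.choose 2 : ℝ) := by exact_mod_cast Nat.choose_pos hn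
  simp only [swapStat_eq, mul_pow]
  rw [← Finset.mul_sum, sum_sq_sum_mul_boolSign _ (fun p hp => (Finset.mem_filter.1 hp).2)
    (fun p => coreFn σ (v p.1, v' p.1) (v p.2, v' p.2)), Fintype.card_fin]
  have h : ∑ p ∈ Finset.univ.filter (fun p : Fin n × Fin n => p.1 < p.2),
      coreFn σ (v p.1, v' p.1) (v p.2, v' p.2) ^ 2 ≤ n.choose 2 * 4 := by
    rw [← card_filter_fst_lt_snd, ← nsmul_eq_mul]
    exact Finset.sum_le_card_nsmul _ _ _ fun p _ => coreFn_sq_le σ _ _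
  calc ((n.choose 2 : ℝ)⁻¹) ^ 2 * (2 ^ n * _)
      ≤ ((n.choose 2 : ℝ)⁻¹) ^ 2 * (2 ^ n * (n.choose 2 * 4)) := by gcongr
    _ = 2 ^ n * (4 / (n.choose 2 : ℝ)) := by field_simp

/-- A one-sided Chebyshev inequality for the counting measure on a finite type. -/
lemma card_filter_lt_mul_sq_le {Ω : Type*} [Fintype Ω] (s : Ω → ℝ) (hs : ∑ x, s x = 0)
    {t c : ℝ} (htc : 0 ≤ t + c) :
    ((Finset.univ.filter fun x => t < s x).card : ℝ) * (t + c) ^ 2 ≤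
      ∑ x, s x ^ 2 + Fintype.card Ω * c ^ 2 := by
  have h : ∑ x, (s x + c) ^ 2 = ∑ x, s x ^ 2 + Fintype.card Ω * c ^ 2 := by
    simp only [add_sq, Finset.sum_add_distrib, ← Finset.sum_mul, ← Finset.mul_sum, hs]
    simp
  rw [← h, ← nsmul_eq_mul]
  refine (Finset.card_nsmul_le_sum _ (fun x => (s x + c) ^ 2) _ fun x hx => ?_).trans
    (Finset.sum_le_univ_sum_of_nonneg fun x => sq_nonneg _)
  have hx := (Finset.mem_filter.1 hx).2
  gcongr

/-- Deterministic bound on the resampling critical value: for any points,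
any `n ≥ 2`, `α ∈ (0,1)` and `σ > 0`, `ĉ_{1−α} ≤ 2/(α(n−1))`. -/
theorem resampling_critical_value_bound
    {d : ℕ} {σ : ℝ} (hσ : 0 < σ) {n : ℕ} (hn : 2 ≤ n)
    {α : ℝ} (hα : α ∈ Set.Ioo (0 : ℝ) 1)
    (v v' : Fin n → EuclideanSpace ℝ (Fin d)) :
    critVal σ α v v' ≤ 2 / (α * ((n : ℝ) - 1)) := by
  obtain ⟨hα0, hα1⟩ := hα
  have hn' : (2 : ℝ) ≤ n := by exact_mod_cast hn
  obtain ⟨m, hm⟩ : ∃ m : ℝ, m = n - 1 := ⟨_, rfl⟩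
  have hm0 : 0 < m := by linarith
  have hN : (0 : ℝ) < 2 ^ n := by positivity
  rw [← hm]
  refine csInf_le ?_ ?_
  · obtain ⟨b, hb⟩ := (Set.finite_range (swapStat σ v v')).bddBelow
    refine ⟨b, fun t ht => ?_⟩
    have hpos : (0 : ℝ) < 1 - α := by linarith
    have hcard := pos_of_mul_pos_right (hpos.trans_le ht) (inv_pos.2 hN).le
    obtain ⟨τ, hτ⟩ := Finset.card_pos.1 (Nat.cast_pos.1 hcard)
    exact (hb ⟨τ, rfl⟩).trans (Finset.mem_filter.1 hτ).2
  · set t : ℝ := 2 / (α * m) with ht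
    have ht0 : 0 < t := by positivity
    have hc0 : 0 < 2 / m := by positivity
    have hcheb := card_filter_lt_mul_sq_le (swapStat σ v v') (sum_swapStat σ v v')
      (add_pos ht0 hc0).le
    have hvar := sum_swapStat_sq_le hn σ v v'
    have hV : 4 / (n.choose 2 : ℝ) ≤ 8 / m ^ 2 := by
      rw [Nat.cast_choose_two, ← hm, div_le_div_iff₀ (by positivity) (by positivity)]
      nlinarith
    have hkey : 8 / m ^ 2 + (2 / m) ^ 2 ≤ α * (t + 2 / m) ^ 2 := by
      have h1 : α * (t + 2 / m) ^ 2 - (8 / m ^ 2 + (2 / m) ^ 2) =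
          4 * (1 - α + α ^ 2) / (α * m ^ 2) := by
        rw [ht]
        field_simp
        ring
      have h2 : 0 ≤ 4 * (1 - α + α ^ 2) / (α * m ^ 2) := by
        have : 0 ≤ 1 - α + α ^ 2 := by nlinarith
        positivity
      linarith
    have hB : ((Finset.univ.filter fun τ => t < swapStat σ v v' τ).card : ℝ) ≤ 2 ^ n * α := by
      refine le_of_mul_le_mul_right ?_ (pow_pos (add_pos ht0 hc0) 2)
      calc _ ≤ _ := hcheb
        _ ≤ 2 ^ n * (8 / m ^ 2) + 2 ^ n * (2 / m) ^ 2 := by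
          have hcard : (Fintype.card (Fin n → Bool) : ℝ) = 2 ^ n := by simp
          rw [hcard]
          gcongr
          exact hvar.trans (by gcongr)
        _ ≤ 2 ^ n * α * (t + 2 / m) ^ 2 := by
          rw [← mul_add, mul_assoc]
          gcongr
    have hsum : ((Finset.univ.filter fun τ => swapStat σ v v' τ ≤ t).card : ℝ) +
        (Finset.univ.filter fun τ => t < swapStat σ v v' τ).card = 2 ^ n := by
      have h := Finset.card_filter_add_card_filter_not (s := Finset.univ)
        (fun τ => swapStat σ v v' τ ≤ t)
      simp only [not_le] at h
      rw [← Nat.cast_add, h]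
      simp
    rw [Set.mem_ofPred_eq, inv_mul_eq_div, le_div_iff₀ hN]
    linarith
end
end

section
/- Let σ > 0 and let ρ_G be a Borel probability measure on ℝ^d × ℝ^d whose two marginals are equal. Then for every Borel probability measure ρ_F on ℝ^d × ℝ^d, the cross term vanishes: ζ′_σ(ρ_G, ρ_F) = 0, and consequently for every δ ∈ (0,1), ζ_σ((1−δ)·ρ_G + δ·ρ_F) = δ²·ζ_σ(ρ_F). -/
open MeasureTheory ProbabilityTheory Filter Real
open scoped ENNReal

noncomputable section

/-- The cross term `ζ′_σ(ρ_G, ρ_F) = ∬ g(w₁,w₂) dρ_G(w₁) dρ_F(w₂)`. -/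
def zetaCross {d : ℕ} (σ : ℝ)
    (ρG ρF : Measure (EuclideanSpace ℝ (Fin d) × EuclideanSpace ℝ (Fin d))) : ℝ :=
  ∫ w₁, ∫ w₂, coreFn σ w₁ w₂ ∂ρF ∂ρG

lemma integral_add_sub_sub_s15 {α : Type*} [MeasurableSpace α] {μ : Measure α} {f₁ f₂ f₃ f₄ : α → ℝ}
    (h₁ : Integrable f₁ μ) (h₂ : Integrable f₂ μ) (h₃ : Integrable f₃ μ) (h₄ : Integrable f₄ μ) :
    ∫ a, (f₁ a + f₂ a - f₃ a - f₄ a) ∂μ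
      = (∫ a, f₁ a ∂μ) + (∫ a, f₂ a ∂μ) - (∫ a, f₃ a ∂μ) - ∫ a, f₄ a ∂μ := by
  rw [integral_sub (f := fun a => f₁ a + f₂ a - f₃ a) ((h₁.add h₂).sub h₃) h₄,
    integral_sub (f := fun a => f₁ a + f₂ a) (h₁.add h₂) h₃, integral_add h₁ h₂]

section GaussianPairing

variable {d : ℕ} (σ : ℝ)

lemma gaussKer_comm (x y : EuclideanSpace ℝ (Fin d)) : gaussKer σ x y = gaussKer σ y x := by
  simp only [gaussKer, norm_sub_rev]

lemma abs_gaussKer_le_one (x y : EuclideanSpace ℝ (Fin d)) : |gaussKer σ x y| ≤ 1 := by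
  rw [gaussKer, Real.abs_exp, Real.exp_le_one_iff, neg_mul]
  exact neg_nonpos.2 (by positivity)

lemma continuous_gaussKer :
    Continuous (fun p : EuclideanSpace ℝ (Fin d) × EuclideanSpace ℝ (Fin d) =>
      gaussKer σ p.1 p.2) := by
  unfold gaussKer
  fun_prop

lemma integrable_gaussKer_comp {α : Type*} [MeasurableSpace α] (μ : Measure α) [IsFiniteMeasure μ]
    {f g : α → EuclideanSpace ℝ (Fin d)} (hf : Measurable f) (hg : Measurable g) :
    Integrable (fun a => gaussKer σ (f a) (g a)) μ :=
  .of_bound ((continuous_gaussKer σ).measurable.comp (hf.prodMk hg)).aestronglyMeasurable 1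
    (.of_forall fun _ => abs_gaussKer_le_one σ _ _)

/-- The bilinear pairing `∬ K_σ(x,y) dν(y) dμ(x)` of two measures. -/
def gaussPairing (μ ν : Measure (EuclideanSpace ℝ (Fin d))) : ℝ :=
  ∫ x, ∫ y, gaussKer σ x y ∂ν ∂μ

lemma integrable_integral_gaussKer_comp {α β : Type*} [MeasurableSpace α] [MeasurableSpace β]
    (μ : Measure α) (ν : Measure β) [IsFiniteMeasure μ] [IsFiniteMeasure ν]
    {f : α → EuclideanSpace ℝ (Fin d)} {g : β → EuclideanSpace ℝ (Fin d)}
    (hf : Measurable f) (hg : Measurable g) :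
    Integrable (fun a => ∫ b, gaussKer σ (f a) (g b) ∂ν) μ :=
  (integrable_gaussKer_comp σ (μ.prod ν) (hf.comp measurable_fst)
    (hg.comp measurable_snd)).integral_prod_left

lemma integrable_integral_gaussKer (μ ν : Measure (EuclideanSpace ℝ (Fin d)))
    [IsFiniteMeasure μ] [IsFiniteMeasure ν] :
    Integrable (fun x => ∫ y, gaussKer σ x y ∂ν) μ :=
  integrable_integral_gaussKer_comp σ μ ν measurable_id measurable_id

lemma gaussPairing_comm (μ ν : Measure (EuclideanSpace ℝ (Fin d))) [IsFiniteMeasure μ]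
    [IsFiniteMeasure ν] : gaussPairing σ μ ν = gaussPairing σ ν μ := by
  unfold gaussPairing
  rw [integral_integral_swap (integrable_gaussKer_comp σ (μ.prod ν) measurable_fst measurable_snd)]
  simp only [gaussKer_comm]

lemma gaussPairing_map {α β : Type*} [MeasurableSpace α] [MeasurableSpace β]
    (μ : Measure α) (ν : Measure β) [IsFiniteMeasure μ] [IsFiniteMeasure ν]
    {f : α → EuclideanSpace ℝ (Fin d)} {g : β → EuclideanSpace ℝ (Fin d)}
    (hf : Measurable f) (hg : Measurable g) :
    gaussPairing σ (μ.map f) (ν.map g) = ∫ a, ∫ b, gaussKer σ (f a) (g b) ∂ν ∂μ := by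
  unfold gaussPairing
  rw [integral_map hf.aemeasurable (integrable_integral_gaussKer σ (μ.map f)
    (ν.map g)).aestronglyMeasurable]
  refine integral_congr_ae (.of_forall fun a => ?_)
  exact integral_map hg.aemeasurable
    (integrable_gaussKer_comp σ (ν.map g) measurable_const measurable_id).aestronglyMeasurable

lemma gaussPairing_smul_add_smul_left (μ₁ μ₂ ν : Measure (EuclideanSpace ℝ (Fin d)))
    [IsFiniteMeasure μ₁] [IsFiniteMeasure μ₂] [IsFiniteMeasure ν] (a b : NNReal) :
    gaussPairing σ (a • μ₁ + b • μ₂) ν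
      = a * gaussPairing σ μ₁ ν + b * gaussPairing σ μ₂ ν := by
  unfold gaussPairing
  rw [integral_add_measure
    (integrable_integral_gaussKer σ (a • μ₁) ν)
    (integrable_integral_gaussKer σ (b • μ₂) ν),
    integral_smul_nnreal_measure, integral_smul_nnreal_measure]
  rfl

lemma gaussPairing_smul_add_smul_right (μ ν₁ ν₂ : Measure (EuclideanSpace ℝ (Fin d)))
    [IsFiniteMeasure μ] [IsFiniteMeasure ν₁] [IsFiniteMeasure ν₂] (a b : NNReal) :
    gaussPairing σ μ (a • ν₁ + b • ν₂)
      = a * gaussPairing σ μ ν₁ + b * gaussPairing σ μ ν₂ := by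
  rw [gaussPairing_comm, gaussPairing_smul_add_smul_left, gaussPairing_comm σ ν₁,
    gaussPairing_comm σ ν₂]

lemma zetaSigma_eq_gaussPairing
    (ρ : Measure (EuclideanSpace ℝ (Fin d) × EuclideanSpace ℝ (Fin d))) :
    zetaSigma σ ρ = gaussPairing σ (ρ.map Prod.fst) (ρ.map Prod.fst)
      + gaussPairing σ (ρ.map Prod.snd) (ρ.map Prod.snd)
      - 2 * gaussPairing σ (ρ.map Prod.fst) (ρ.map Prod.snd) := rfl

lemma zetaCross_eq_gaussPairing
    (ρG ρF : Measure (EuclideanSpace ℝ (Fin d) × EuclideanSpace ℝ (Fin d)))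
    [IsFiniteMeasure ρG] [IsFiniteMeasure ρF] :
    zetaCross σ ρG ρF = gaussPairing σ (ρG.map Prod.fst) (ρF.map Prod.fst)
      + gaussPairing σ (ρG.map Prod.snd) (ρF.map Prod.snd)
      - gaussPairing σ (ρG.map Prod.fst) (ρF.map Prod.snd)
      - gaussPairing σ (ρG.map Prod.snd) (ρF.map Prod.fst) := by
  have inner {f g : EuclideanSpace ℝ (Fin d) × EuclideanSpace ℝ (Fin d) →
      EuclideanSpace ℝ (Fin d)}
      (hg : Measurable g) (w) :
      Integrable (fun w₂ => gaussKer σ (f w) (g w₂)) ρF :=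
    integrable_gaussKer_comp σ ρF measurable_const hg
  have outer {f g : EuclideanSpace ℝ (Fin d) × EuclideanSpace ℝ (Fin d) →
      EuclideanSpace ℝ (Fin d)}
      (hf : Measurable f) (hg : Measurable g) :=
    integrable_integral_gaussKer_comp σ ρG ρF hf hg
  have m₁ : Measurable (Prod.fst : EuclideanSpace ℝ (Fin d) × EuclideanSpace ℝ (Fin d) → _) :=
    measurable_fst
  have m₂ : Measurable (Prod.snd : EuclideanSpace ℝ (Fin d) × EuclideanSpace ℝ (Fin d) → _) :=
    measurable_snd
  rw [gaussPairing_map σ ρG ρF m₁ m₁, gaussPairing_map σ ρG ρF m₂ m₂,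
    gaussPairing_map σ ρG ρF m₁ m₂, gaussPairing_map σ ρG ρF m₂ m₁,
    ← integral_add_sub_sub_s15 (outer m₁ m₁) (outer m₂ m₂) (outer m₁ m₂) (outer m₂ m₁)]
  exact integral_congr_ae (.of_forall fun w => integral_add_sub_sub_s15
    (inner (f := Prod.fst) m₁ w) (inner (f := Prod.snd) m₂ w)
    (inner (f := Prod.fst) m₂ w) (inner (f := Prod.snd) m₁ w))

end GaussianPairing

/-- If the two marginals of `ρ_G` are equal, then the cross term vanishes,
`ζ′_σ(ρ_G, ρ_F) = 0`, and consequently `ζ_σ((1−δ)ρ_G + δρ_F) = δ² ζ_σ(ρ_F)` for every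
`δ ∈ (0,1)`. -/
theorem zetaCross_eq_zero_and_mixture
    {d : ℕ} {σ : ℝ} (hσ : 0 < σ)
    (ρG : Measure (EuclideanSpace ℝ (Fin d) × EuclideanSpace ℝ (Fin d)))
    [IsProbabilityMeasure ρG]
    (hmarg : ρG.map Prod.fst = ρG.map Prod.snd) :
    ∀ ρF : Measure (EuclideanSpace ℝ (Fin d) × EuclideanSpace ℝ (Fin d)),
      IsProbabilityMeasure ρF →
      zetaCross σ ρG ρF = 0
        ∧ ∀ δ : ℝ, δ ∈ Set.Ioo (0 : ℝ) 1 →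
            zetaSigma σ ((1 - δ.toNNReal) • ρG + δ.toNNReal • ρF)
              = δ ^ 2 * zetaSigma σ ρF := by
  intro ρF _
  refine ⟨?_, fun δ hδ => ?_⟩
  · rw [zetaCross_eq_gaussPairing, hmarg]
    ring
  · have hmix {f : EuclideanSpace ℝ (Fin d) × EuclideanSpace ℝ (Fin d) → EuclideanSpace ℝ (Fin d)}
        (hf : Measurable f) :
        ((1 - δ.toNNReal) • ρG + δ.toNNReal • ρF).map f
          = (1 - δ.toNNReal) • ρG.map f + δ.toNNReal • ρF.map f := by
      rw [Measure.map_add _ _ hf, Measure.map_smul, Measure.map_smul]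
    rw [zetaSigma_eq_gaussPairing, zetaSigma_eq_gaussPairing, hmix measurable_fst,
      hmix measurable_snd, hmarg]
    simp only [gaussPairing_smul_add_smul_left, gaussPairing_smul_add_smul_right]
    rw [gaussPairing_comm σ (ρF.map Prod.fst) (ρG.map Prod.snd),
      gaussPairing_comm σ (ρF.map Prod.snd) (ρG.map Prod.snd), Real.coe_toNNReal δ hδ.1.le]
    ring
end
end
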